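/- Let K be a field and let O₁ and O₂ be solv-henselian valuation rings of K which are incomparable (neither contains the other). Then the residue fields of both O₁ and O₂ are solv-closed. -/

import Mathlib

noncomputable section

/-- The maximal solvable extension of `K` inside an ambient field extension `Ω`:
the compositum of all finite Galois subextensions of `Ω/K` with solvable Galois group. -/
def maxSolvableExt (K Ω : Type*) [Field K] [Field Ω] [Algebra K Ω] :
    IntermediateField K Ω :=
  ⨆ L : {L : IntermediateField K Ω //
      FiniteDimensional K ↥L ∧ IsGalois K ↥L ∧ IsSolvable (↥L ≃ₐ[K] ↥L)}, L.1

/-- `K^solv`, the maximal solvable extension of `K` (inside a fixed algebraic closure). -/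
abbrev solvClosure (K : Type*) [Field K] : IntermediateField K (AlgebraicClosure K) :=
  maxSolvableExt K (AlgebraicClosure K)

/-- A valuation (subring) of `K` is solv-henselian if it extends uniquely to `K^solv`. -/
def IsSolvHenselian {K : Type*} [Field K] (O : ValuationSubring K) : Prop :=
  ∃! O' : ValuationSubring ↥(solvClosure K),
    O'.comap (algebraMap K ↥(solvClosure K)) = O

/-- A field is solv-closed if it admits no nontrivial finite Galois extension with
solvable Galois group. -/
def IsSolvClosed (K : Type*) [Field K] : Prop :=
  ∀ L : IntermediateField K (AlgebraicClosure K),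
    FiniteDimensional K ↥L → IsGalois K ↥L → IsSolvable (↥L ≃ₐ[K] ↥L) → L = ⊥

open Finset Polynomial

/-- The polynomial function `∏_{i < p} (y - (1 + ζ + ⋯ + ζ ^ (i - 1)))`. -/
def kummerArtinSchreier (p : ℕ) {R : Type*} [CommRing R] (ζ y : R) : R :=
  ∏ i ∈ range p, (y - ∑ j ∈ range i, ζ ^ j)

section Ring
variable {R S : Type*} [CommRing R] [CommRing S] {p : ℕ} {ζ : R}

lemma map_kummerArtinSchreier (f : R →+* S) (p : ℕ) (ζ y : R) :
    f (kummerArtinSchreier p ζ y) = kummerArtinSchreier p (f ζ) (f y) := by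
  simp [kummerArtinSchreier]

lemma pow_eq_one_of_geom_sum_eq_zero (h : ∑ j ∈ range p, ζ ^ j = 0) : ζ ^ p = 1 := by
  have := geom_sum_mul ζ p
  rw [h, zero_mul] at this
  exact (sub_eq_zero.1 this.symm)

lemma kummerArtinSchreier_mul_add_one (h : ∑ j ∈ range p, ζ ^ j = 0) (y : R) :
    kummerArtinSchreier p ζ (ζ * y + 1) = kummerArtinSchreier p ζ y := by
  have h1 := pow_eq_one_of_geom_sum_eq_zero h
  cases p with
  | zero => simp [kummerArtinSchreier]
  | succ n =>
    rw [kummerArtinSchreier, prod_range_succ', kummerArtinSchreier, prod_range_succ]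
    have h2 : ∀ i ∈ range n, ζ * y + 1 - ∑ j ∈ range (i + 1), ζ ^ j =
        ζ * (y - ∑ j ∈ range i, ζ ^ j) := fun i _ ↦ by rw [geom_sum_succ]; ring
    rw [prod_congr rfl h2, prod_mul_distrib, prod_const, card_range]
    rw [sum_range_succ] at h
    rw [pow_succ] at h1
    simp only [range_zero, sum_empty, sub_zero]
    linear_combination (∏ i ∈ range n, (y - ∑ j ∈ range i, ζ ^ j)) * (y * h1 + h)

lemma kummerArtinSchreier_pow_mul_add (h : ∑ j ∈ range p, ζ ^ j = 0) (i : ℕ) (y : R) :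
    kummerArtinSchreier p ζ (ζ ^ i * y + ∑ j ∈ range i, ζ ^ j) = kummerArtinSchreier p ζ y := by
  induction i with
  | zero => simp
  | succ i ih =>
    rw [← ih, ← kummerArtinSchreier_mul_add_one h (ζ ^ i * y + _), geom_sum_succ]
    congr 1
    ring

lemma isUnit_geom_sum_of_coprime (h : ∑ j ∈ range p, ζ ^ j = 0) (hp : 1 < p) {i : ℕ}
    (hi : i.Coprime p) : IsUnit (∑ j ∈ range i, ζ ^ j) := by
  have h1 := pow_eq_one_of_geom_sum_eq_zero h
  have key : ∀ m, ∑ j ∈ range (p * m), ζ ^ j = 0 := fun m ↦ by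
    induction m with
    | zero => simp
    | succ m ih =>
      rw [mul_add, mul_one, sum_range_add, ih, zero_add]
      simp [pow_add, pow_mul, h1, h]
  obtain ⟨m, hm⟩ := Nat.exists_mul_mod_eq_one_of_coprime hi hp
  refine IsUnit.of_mul_eq_one (∑ j ∈ range m, (ζ ^ i) ^ j) ?_
  have h3 : ∑ j ∈ range (i * m), ζ ^ j = 1 := by
    rw [← Nat.div_add_mod (i * m) p, hm.2, sum_range_succ, key]
    simp [pow_mul, h1]
  rw [← h3]
  clear * -
  induction m with
  | zero => simp
  | succ m ih =>
    rw [sum_range_succ, mul_add, ih, mul_add i, mul_one, sum_range_add]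
    simp only [pow_add, pow_mul, sum_mul]
    exact congrArg _ (sum_congr rfl fun _ _ ↦ mul_comm _ _)

lemma IsLocalRing.isUnit_add_of_mem_maximalIdeal [IsLocalRing R] {u x : R} (hu : IsUnit u)
    (hx : x ∈ IsLocalRing.maximalIdeal R) : IsUnit (u + x) := by
  by_contra hn
  have := sub_mem ((IsLocalRing.mem_maximalIdeal _).2 hn) hx
  rw [add_sub_cancel_right] at this
  exact (IsLocalRing.mem_maximalIdeal _).1 this hu

/-- A root of a Kummer-Artin-Schreier equation in a local ring is unique in the maximal ideal. -/
lemma kummerArtinSchreier_injOn [IsLocalRing R] (h : ∑ j ∈ range p, ζ ^ j = 0) (hp : p.Prime)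
    {y z : R} (hy : y ∈ IsLocalRing.maximalIdeal R) (hz : z ∈ IsLocalRing.maximalIdeal R)
    (hyz : kummerArtinSchreier p ζ y = kummerArtinSchreier p ζ z) : y = z := by
  obtain ⟨n, rfl⟩ : ∃ n, p = n + 1 := ⟨p - 1, by have := hp.pos; omega⟩
  let q : R[X] := ∏ i ∈ range n, (X - C (∑ j ∈ range (i + 1), ζ ^ j))
  have hq : ∀ w, kummerArtinSchreier (n + 1) ζ w = q.eval w * w := fun w ↦ by
    simp only [kummerArtinSchreier, prod_range_succ', q, eval_prod, eval_sub, eval_X, eval_C,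
      range_zero, sum_empty, sub_zero]
  have hq0 : IsUnit (q.eval y) := by
    simp only [q, eval_prod, eval_sub, eval_X, eval_C]
    refine IsUnit.prod_iff.2 fun i hi ↦ ?_
    have h1 := isUnit_geom_sum_of_coprime (i := i + 1) h hp.one_lt
      (Nat.coprime_of_lt_prime (by simp) (by simpa using hi) hp).symm
    rw [sub_eq_neg_add]
    exact IsLocalRing.isUnit_add_of_mem_maximalIdeal h1.neg hy
  obtain ⟨c, hc⟩ := q.sub_dvd_eval_sub y z
  rw [hq, hq] at hyz
  have h0 : (y - z) * (q.eval y + z * c) = 0 := by linear_combination hyz - z * hc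
  have hu : IsUnit (q.eval y + z * c) :=
    IsLocalRing.isUnit_add_of_mem_maximalIdeal hq0 (Ideal.mul_mem_right _ _ hz)
  exact sub_eq_zero.1 ((hu.mul_left_eq_zero).1 h0)

end Ring

lemma mul_kummerArtinSchreier_of_isPrimitiveRoot {R : Type*} [CommRing R] [IsDomain R] {p : ℕ}
    {ζ : R} (hζ : IsPrimitiveRoot ζ p) (hp : 0 < p) (y : R) :
    (ζ - 1) ^ p * kummerArtinSchreier p ζ y = (1 + (ζ - 1) * y) ^ p - 1 := by
  have := congrArg (eval (1 + (ζ - 1) * y)) (X_pow_sub_C_eq_prod hζ hp (one_pow p))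
  simp only [eval_sub, eval_pow, eval_X, eval_C, eval_prod, mul_one] at this
  rw [this, kummerArtinSchreier, ← card_range p, ← prod_const, card_range, ← prod_mul_distrib]
  refine prod_congr rfl fun i _ ↦ ?_
  linear_combination -geom_sum_mul ζ i

lemma kummerArtinSchreier_one_of_charP {R : Type*} [CommRing R] {p : ℕ} [Fact p.Prime]
    [CharP R p] (y : R) : kummerArtinSchreier p 1 y = y ^ p - y := by
  have h : (X ^ p - X : (ZMod p)[X]) = ∏ a : ZMod p, (X - C a) := by
    have hp := (Fact.out : p.Prime).one_lt
    have h1 := FiniteField.roots_X_pow_card_sub_X (ZMod p)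
    have h2 := FiniteField.X_pow_card_sub_X_natDegree_eq (ZMod p) hp
    rw [ZMod.card] at h1
    have h3 : (X ^ p - X : (ZMod p)[X]).Monic := monic_X_pow_sub (by simpa using hp)
    rw [← prod_multiset_X_sub_C_of_monic_of_roots_card_eq h3 (by rw [h1, h2]; simp), h1]
    rfl
  let _ := ZMod.algebra R p
  have h2 := congrArg (aeval y) h
  simp only [map_sub, map_pow, aeval_X, map_prod, aeval_C] at h2
  rw [h2, kummerArtinSchreier]
  have hp := NeZero.of_pos (Fact.out : p.Prime).pos
  refine (prod_bij (fun a _ ↦ (a : ZMod p).val) (fun a _ ↦ by simpa using ZMod.val_lt a)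
    (fun a _ b _ hab ↦ ZMod.val_injective p hab) (fun i hi ↦ ⟨i, mem_univ _,
      ZMod.val_cast_of_lt (by simpa using hi)⟩) fun a _ ↦ ?_).symm
  simp only [one_pow, sum_const, card_range, nsmul_eq_mul, mul_one]
  rw [← map_natCast (algebraMap (ZMod p) R), ZMod.natCast_zmod_val]

namespace ValuationSubring

variable {M : Type*} [Field M] {p : ℕ} {ζ : M}

lemma mem_of_pow_eq_one (A : ValuationSubring M) {x : M} {n : ℕ} (hn : n ≠ 0) (hx : x ^ n = 1) :
    x ∈ A := by
  rw [← valuation_le_one_iff]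
  have h : A.valuation x ^ n = 1 := by rw [← map_pow, hx, map_one]
  exact ((pow_eq_one_iff_of_nonneg zero_le hn).1 h).le

/-- Elements of one of two incomparable valuation rings can be approximated by elements of the
maximal ideal of the other. -/
lemma exists_sub_mem_nonunits_of_not_le {A B : ValuationSubring M} (hAB : ¬ A ≤ B)
    (hBA : ¬ B ≤ A) {a : M} (ha : a ∈ A) : ∃ t, t - a ∈ A.nonunits ∧ t ∈ B.nonunits := by
  obtain ⟨u, huA, huB⟩ := SetLike.not_le_iff_exists.1 hAB
  obtain ⟨v, hvB, hvA⟩ := SetLike.not_le_iff_exists.1 hBA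
  simp only [← valuation_le_one_iff, not_le, mem_nonunits_iff] at *
  have hv0 : v ≠ 0 := by rintro rfl; simp at hvA
  -- `w` lies in the maximal ideal of `A`, and both `1 + w` and `(1 + w) / a` lie outside of `B`
  have key : ∃ w, A.valuation w < 1 ∧ 1 < B.valuation w ∧ B.valuation a < B.valuation w := by
    have hvA' : A.valuation v⁻¹ < 1 := by rw [map_inv₀]; exact inv_lt_one_of_one_lt₀ hvA
    have hvB' : 1 ≤ B.valuation v⁻¹ := by
      rw [map_inv₀]; exact (one_le_inv₀ (by simpa [zero_lt_iff] using hv0)).2 hvB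
    have hw : 1 < B.valuation (u * v⁻¹) := by
      rw [map_mul]; exact lt_of_lt_of_le huB (le_mul_of_one_le_right' hvB')
    have hwA : A.valuation (u * v⁻¹) < 1 := by
      rw [map_mul]; exact mul_lt_one_of_nonneg_of_lt_one_right huA zero_le hvA'
    by_cases haB : B.valuation a ≤ 1
    · exact ⟨u * v⁻¹, hwA, hw, haB.trans_lt hw⟩
    · rw [not_le] at haB
      refine ⟨a * (u * v⁻¹), ?_, ?_, ?_⟩
      · rw [map_mul]; exact mul_lt_one_of_nonneg_of_lt_one_right ha zero_le hwA
      · rw [map_mul]; exact one_lt_mul'' haB hw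
      · rw [map_mul]
        exact lt_mul_of_one_lt_right (zero_lt_one.trans haB) hw
  obtain ⟨w, hwA, hwB, haw⟩ := key
  have h1A : A.valuation (1 + w) = 1 := Valuation.map_one_add_of_lt _ hwA
  have h1B : B.valuation (1 + w) = B.valuation w := by
    rw [add_comm]; exact Valuation.map_add_eq_of_lt_left _ (by simpa using hwB)
  have hne : 1 + w ≠ 0 := by intro h; simp [h] at h1A
  refine ⟨a / (1 + w), ?_, ?_⟩
  · have : a / (1 + w) - a = -(a * w) / (1 + w) := by field_simp; ring
    rw [this, map_div₀, h1A, div_one, Valuation.map_neg, map_mul]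
    exact mul_lt_one_of_nonneg_of_lt_one_right ha zero_le hwA
  · rw [map_div₀, h1B]
    exact (div_lt_one₀ (zero_lt_one.trans hwB)).2 haw

lemma exists_kummerArtinSchreier_residue_eq {A B : ValuationSubring M} (hAB : ¬ A ≤ B)
    (hBA : ¬ B ≤ A) (hp : p ≠ 0) (ζA : A)
    (hB : ∀ t ∈ B.nonunits, ∃ y, kummerArtinSchreier p (ζA : M) y = t)
    (a : IsLocalRing.ResidueField A) :
    ∃ b, kummerArtinSchreier p (IsLocalRing.residue A ζA) b = a := by
  obtain ⟨a, rfl⟩ := IsLocalRing.residue_surjective a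
  obtain ⟨t, hta, htB⟩ := exists_sub_mem_nonunits_of_not_le hAB hBA a.2
  obtain ⟨y, hy⟩ := hB t htB
  have htA : t ∈ A := by simpa using AddMemClass.add_mem (nonunits_subset hta) a.2
  have hyA : y ∈ A := by
    by_contra hyA
    have h1 : ∀ i ∈ range p, 1 < A.valuation (y - ∑ j ∈ range i, (ζA : M) ^ j) := by
      intro i _
      rw [← not_le, valuation_le_one_iff]
      intro h
      refine hyA ?_
      have := AddMemClass.add_mem h (_root_.sum_mem fun j (_ : j ∈ range i) ↦ pow_mem ζA.2 j)
      simpa using this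
    have h2 := (valuation_le_one_iff _ _).2 htA
    rw [← hy, kummerArtinSchreier, map_prod, ← not_lt] at h2
    obtain ⟨n, rfl⟩ := Nat.exists_eq_succ_of_ne_zero hp
    rw [prod_range_succ] at h2
    exact h2 ((h1 n (by simp)).trans_le (le_mul_of_one_le_left'
      (one_le_prod' fun i hi ↦ (h1 i (mem_range.2 ((mem_range.1 hi).trans n.lt_succ_self))).le)))
  refine ⟨IsLocalRing.residue A ⟨y, hyA⟩, ?_⟩
  rw [← map_kummerArtinSchreier, ← sub_eq_zero, ← map_sub, IsLocalRing.residue_eq_zero_iff,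
    ← coe_mem_nonunits_iff]
  have : ((kummerArtinSchreier p ζA ⟨y, hyA⟩ : A) : M) = t := by
    rw [← hy]; exact map_kummerArtinSchreier A.subtype p ζA ⟨y, hyA⟩
  rw [AddSubgroupClass.coe_sub, this]
  exact hta

/-- Descent of solutions of Kummer-Artin-Schreier equations to the base field. -/
lemma exists_kummerArtinSchreier_eq_of_mem_nonunits {L : Type*} [Field L] [Algebra M L]
    [IsGalois M L] (O : ValuationSubring L) (hO : ∀ σ : Gal(L/M), ∀ x ∈ O, σ x ∈ O)
    (hp : p.Prime) (hζ : ∑ j ∈ range p, ζ ^ j = 0) {t : M}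
    (ht : algebraMap M L t ∈ O.nonunits) {y : L}
    (hy : kummerArtinSchreier p (algebraMap M L ζ) y = algebraMap M L t) :
    ∃ y₀, kummerArtinSchreier p ζ y₀ = t := by
  set ζ' := algebraMap M L ζ with hζ'
  have hs : ∑ j ∈ range p, ζ' ^ j = 0 := by simpa using congrArg (algebraMap M L) hζ
  have h1 := pow_eq_one_of_geom_sum_eq_zero hs
  have hζ0 : ζ' ≠ 0 := by rintro h; simp [h, hp.ne_zero] at h1
  have hζO : ζ' ∈ O := O.mem_of_pow_eq_one hp.ne_zero h1
  have hvζ : O.valuation ζ' = 1 := by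
    refine (pow_eq_one_iff_of_nonneg zero_le hp.ne_zero).1 ?_
    rw [← map_pow, h1, map_one]
  obtain ⟨i, -, hi⟩ : ∃ i ∈ range p, O.valuation (y - ∑ j ∈ range i, ζ' ^ j) < 1 := by
    by_contra! h
    rw [← hy, mem_nonunits_iff, kummerArtinSchreier, map_prod, ← not_le] at ht
    exact ht (one_le_prod' h)
  set z := (ζ' ^ i)⁻¹ * (y - ∑ j ∈ range i, ζ' ^ j)
  have hz : z ∈ O.nonunits := by
    rw [mem_nonunits_iff, map_mul, map_inv₀, map_pow, hvζ]
    simpa using hi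
  have hzt : kummerArtinSchreier p ζ' z = algebraMap M L t := by
    rw [← hy, ← kummerArtinSchreier_pow_mul_add hs i]
    congr 1
    simp only [z]
    field_simp
    ring
  have hfix : ∀ σ : Gal(L/M), σ z = z := by
    intro σ
    have hσz : σ z ∈ O.nonunits := by
      rw [mem_nonunits_iff_or] at hz ⊢
      refine hz.imp (by simp +contextual) fun h h' ↦ h ?_
      simpa using hO σ⁻¹ _ h'
    obtain ⟨hzO, hz⟩ := mem_nonunits_iff_exists_mem_maximalIdeal.1 hz
    obtain ⟨hσzO, hσz⟩ := mem_nonunits_iff_exists_mem_maximalIdeal.1 hσz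
    have := kummerArtinSchreier_injOn (R := O) (ζ := ⟨ζ', hζO⟩) (p := p)
      (Subtype.ext (by simpa using hs)) hp hσz hz (Subtype.ext ?_)
    · exact congrArg Subtype.val this
    · have e := map_kummerArtinSchreier O.subtype p ⟨ζ', hζO⟩
      refine (e _).trans (Eq.trans ?_ (e _).symm)
      change kummerArtinSchreier p ζ' (σ z) = kummerArtinSchreier p ζ' z
      have := map_kummerArtinSchreier (σ : L →+* L) p ζ' z
      rw [hzt] at this ⊢
      simpa [hζ'] using this.symm
  obtain ⟨y₀, hy₀⟩ := (InfiniteGalois.mem_range_algebraMap_iff_fixed z).2 hfix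
  refine ⟨y₀, (algebraMap M L).injective ?_⟩
  rw [map_kummerArtinSchreier, hy₀, hzt]

end ValuationSubring

universe u

section Galois

/-- A nontrivial finite solvable group has a normal subgroup of prime index. -/
lemma Group.IsSolvable.exists_normal_index_prime (G : Type*) [Group G] [Finite G] [Nontrivial G]
    [Group.IsSolvable G] : ∃ N : Subgroup G, N.Normal ∧ N.index.Prime := by
  obtain ⟨N, ⟨hN, hNt⟩, hmax⟩ := (Set.toFinite {N : Subgroup G | N.Normal ∧ N ≠ ⊤}).exists_maximal
    ⟨⊥, inferInstance, bot_ne_top⟩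
  have : Nontrivial (G ⧸ N) := QuotientGroup.nontrivial_iff.2 hNt
  have : IsSimpleGroup (G ⧸ N) := ⟨fun H hH ↦ by
    by_cases ht : H.comap (QuotientGroup.mk' N) = ⊤
    · right
      rw [← Subgroup.map_comap_eq_self_of_surjective (QuotientGroup.mk'_surjective N) H, ht,
        ← MonoidHom.range_eq_map, MonoidHom.range_eq_top.2 (QuotientGroup.mk'_surjective N)]
    · left
      have h1 := hmax (y := H.comap (QuotientGroup.mk' N)) ⟨inferInstance, ht⟩
        (by simpa using Subgroup.ker_le_comap (QuotientGroup.mk' N) H)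
      rw [← Subgroup.map_comap_eq_self_of_surjective (QuotientGroup.mk'_surjective N) H,
        eq_bot_iff]
      refine (Subgroup.map_mono h1).trans ?_
      simp⟩
  have hc := IsSimpleGroup.comm_iff_isSolvable.2
    (Group.isSolvable_of_surjective (QuotientGroup.mk'_surjective N))
  let _ : CommGroup (G ⧸ N) := { mul_comm := hc }
  exact ⟨N, hN, CommGroup.is_simple_iff_prime_card.1 inferInstance⟩

lemma IsGalois.exists_intermediateField_finrank_prime {k E : Type*} [Field k] [Field E]
    [Algebra k E] [FiniteDimensional k E] [IsGalois k E] [Group.IsSolvable Gal(E/k)]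
    (h : Module.finrank k E ≠ 1) :
    ∃ F : IntermediateField k E, IsGalois k F ∧ (Module.finrank k F).Prime := by
  have : Nontrivial Gal(E/k) := by
    rw [← Finite.one_lt_card_iff_nontrivial, IsGalois.card_aut_eq_finrank]
    have := Module.finrank_pos (R := k) (M := E)
    omega
  obtain ⟨N, hN, hp⟩ := Group.IsSolvable.exists_normal_index_prime Gal(E/k)
  refine ⟨IntermediateField.fixedField N, inferInstance, ?_⟩
  rwa [IntermediateField.finrank_eq_fixingSubgroup_index,
    IntermediateField.fixingSubgroup_fixedField]

variable {k E : Type*} [Field k] [Field E] [Algebra k E] {p : ℕ}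

/-- Artin-Schreier theory: a cyclic extension of degree `p` in characteristic `p` is generated
by a solution of an Artin-Schreier equation. -/
lemma IsGalois.exists_artinSchreier_of_finrank_eq_char [Fact p.Prime] [CharP k p]
    [FiniteDimensional k E] [IsGalois k E] (h : Module.finrank k E = p) :
    ∃ (σ : Gal(E/k)) (y : E) (a : k), σ y = y + 1 ∧ y ^ p - y = algebraMap k E a := by
  have hp : p.Prime := Fact.out
  have hcard : Nat.card Gal(E/k) = p := by rw [IsGalois.card_aut_eq_finrank, h]
  have : IsCyclic Gal(E/k) := isCyclic_of_prime_card hcard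
  obtain ⟨σ, hσ⟩ := IsCyclic.exists_generator (α := Gal(E/k))
  have hfix : ∀ x : E, σ x = x → ∃ a, algebraMap k E a = x := by
    intro x hx
    refine (IsGalois.mem_range_algebraMap_iff_fixed x).2 fun τ ↦ ?_
    have : Subgroup.zpowers σ ≤ MulAction.stabilizer Gal(E/k) x := by
      rw [Subgroup.zpowers_le]; exact hx
    exact this (hσ τ)
  have hσ1 : σ ≠ 1 := by
    rintro rfl
    have : Nat.card Gal(E/k) = 1 := by
      rw [Nat.card_eq_one_iff_unique]
      refine ⟨⟨fun a b ↦ ?_⟩, ⟨1⟩⟩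
      have ha := hσ a
      have hb := hσ b
      simp only [Subgroup.zpowers_one_eq_bot, Subgroup.mem_bot] at ha hb
      rw [ha, hb]
    exact hp.one_lt.ne' (hcard.symm.trans this)
  have : CharP (Module.End k E) p := charP_of_injective_algebraMap
    (FaithfulSMul.algebraMap_injective k (Module.End k E)) p
  let s : Module.End k E := σ.toLinearMap
  have hs : ∀ n : ℕ, ∀ x, (s ^ n) x = (σ ^ n) x := fun n ↦ by
    induction n with
    | zero => intro x; rfl
    | succ n ih => intro x; rw [pow_succ, pow_succ, Module.End.mul_apply, ih]; rfl
  have hnil : (s - 1) ^ p = 0 := by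
    rw [sub_pow_char_of_commute p (Commute.one_right s), one_pow, sub_eq_zero]
    ext x
    rw [hs, ← hcard, pow_card_eq_one']
    rfl
  have hs1 : s - 1 ≠ 0 := fun h ↦ hσ1 (AlgEquiv.ext fun x ↦ by
    simpa [s] using LinearMap.congr_fun (sub_eq_zero.1 h) x)
  classical
  have hex : ∃ n, (s - 1) ^ n = 0 := ⟨p, hnil⟩
  obtain ⟨n, hn⟩ : ∃ n, Nat.find hex = n + 2 := by
    have h0 : Nat.find hex ≠ 0 := fun h ↦ by
      have := Nat.find_spec hex
      rw [h] at this
      simp at this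
    have h1 : Nat.find hex ≠ 1 := fun h ↦ by
      have := Nat.find_spec hex
      rw [h, pow_one] at this
      exact hs1 this
    exact ⟨Nat.find hex - 2, by omega⟩
  have hn0 : (s - 1) ^ (n + 2) = 0 := hn ▸ Nat.find_spec hex
  have hn1 : (s - 1) ^ (n + 1) ≠ 0 := Nat.find_min hex (by omega)
  obtain ⟨w, hw⟩ := not_forall.1 fun h ↦ hn1 (LinearMap.ext h)
  obtain ⟨c, hc⟩ := hfix (((s - 1) ^ (n + 1)) w) (by
    have := LinearMap.congr_fun hn0 w
    rw [pow_succ', Module.End.mul_apply, LinearMap.sub_apply] at this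
    exact sub_eq_zero.1 this)
  have hc0 : c ≠ 0 := by rintro rfl; simp [← hc] at hw
  have hsub : σ (((s - 1) ^ n) w) - ((s - 1) ^ n) w = algebraMap k E c := by
    rw [hc, pow_succ', Module.End.mul_apply]; rfl
  have hy : σ (algebraMap k E c⁻¹ * ((s - 1) ^ n) w) =
      algebraMap k E c⁻¹ * ((s - 1) ^ n) w + 1 := by
    rw [map_mul, AlgEquiv.commutes, ← sub_eq_iff_eq_add', ← mul_sub, hsub, ← map_mul,
      inv_mul_cancel₀ hc0, map_one]
  obtain ⟨a, ha⟩ := hfix ((algebraMap k E c⁻¹ * ((s - 1) ^ n) w) ^ p -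
    algebraMap k E c⁻¹ * ((s - 1) ^ n) w) (by
      have : CharP E p := charP_of_injective_algebraMap (algebraMap k E).injective p
      rw [map_sub, map_pow, hy, add_pow_char, one_pow]
      ring)
  exact ⟨σ, _, a, hy, ha.symm⟩

lemma isPrimitiveRoot_or_of_geom_sum_eq_zero (hp : p.Prime) {ζ : k}
    (hζ : ∑ j ∈ range p, ζ ^ j = 0) : IsPrimitiveRoot ζ p ∨ ζ = 1 ∧ CharP k p := by
  by_cases h : ζ = 1
  · right
    refine ⟨h, ?_⟩
    have : Fact p.Prime := ⟨hp⟩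
    rw [h] at hζ
    simp only [one_pow, sum_const, card_range, nsmul_eq_mul, mul_one] at hζ
    exact ringChar.of_eq (CharP.ringChar_of_prime_eq_zero hp hζ)
  · left
    have : Fact p.Prime := ⟨hp⟩
    rw [← orderOf_eq_prime (pow_eq_one_of_geom_sum_eq_zero hζ) h]
    exact IsPrimitiveRoot.orderOf ζ

/-- If the Kummer-Artin-Schreier map of `k` is surjective, then `k` has no Galois extensions of
degree `p`. -/
lemma IsGalois.finrank_ne_of_surjective_kummerArtinSchreier (hp : p.Prime) {ζ : k}
    (hζ : ∑ j ∈ range p, ζ ^ j = 0)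
    (hsurj : Function.Surjective (kummerArtinSchreier p ζ)) [IsGalois k E] :
    Module.finrank k E ≠ p := by
  intro h
  have : Fact p.Prime := ⟨hp⟩
  have : FiniteDimensional k E := Module.finite_of_finrank_pos (h ▸ hp.pos)
  rcases isPrimitiveRoot_or_of_geom_sum_eq_zero hp hζ with hprim | ⟨rfl, hchar⟩
  · have : IsCyclic Gal(E/k) :=
      isCyclic_of_prime_card (p := p) (by rw [IsGalois.card_aut_eq_finrank, h])
    have hne : (primitiveRoots (Module.finrank k E) k).Nonempty :=
      ⟨ζ, (mem_primitiveRoots (h ▸ hp.pos)).2 (h ▸ hprim)⟩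
    obtain ⟨α, ⟨a, ha⟩, hα⟩ := exists_root_adjoin_eq_top_of_isCyclic k E hne
    have hirr := irreducible_X_pow_sub_C_of_root_adjoin_eq_top ha.symm hα
    rw [h] at hirr
    obtain ⟨b, hb⟩ := hsurj ((a - 1) / (ζ - 1) ^ p)
    have hζ1 : (ζ - 1) ^ p ≠ 0 := pow_ne_zero _ (sub_ne_zero.2 (hprim.ne_one hp.one_lt))
    have hpow := mul_kummerArtinSchreier_of_isPrimitiveRoot hprim hp.pos b
    rw [hb, mul_div_cancel₀ _ hζ1, sub_left_inj] at hpow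
    have hd := degree_eq_one_of_irreducible_of_root (x := 1 + (ζ - 1) * b) hirr (by simp [hpow])
    rw [degree_X_pow_sub_C hp.pos] at hd
    exact hp.one_lt.ne' (by exact_mod_cast hd)
  · obtain ⟨σ, y, a, hσ, hy⟩ := IsGalois.exists_artinSchreier_of_finrank_eq_char h
    obtain ⟨b, rfl⟩ := hsurj a
    have : CharP E p := charP_of_injective_algebraMap (algebraMap k E).injective p
    rw [kummerArtinSchreier_one_of_charP, map_sub, map_pow] at hy
    have h0 : kummerArtinSchreier p 1 (y - algebraMap k E b) = 0 := by
      rw [kummerArtinSchreier_one_of_charP, sub_pow_char]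
      linear_combination hy
    obtain ⟨i, -, hi⟩ := prod_eq_zero_iff.1 h0
    have hy' : y = algebraMap k E (b + i) := by
      rw [map_add, map_natCast]
      simp only [one_pow, sum_const, card_range, nsmul_eq_mul, mul_one] at hi
      linear_combination hi
    rw [hy', AlgEquiv.commutes] at hσ
    simp at hσ

/-- Base change of a Galois extension of prime degree `p` along an extension all of whose elements
have degree less than `p`. -/
lemma IsGalois.exists_finrank_eq_of_degree_lt {k' : Type*} [Field k'] [Algebra k k']
    (hp : p.Prime)
    (hdeg : ∀ α : k', ∃ g : k[X], g.Monic ∧ g.natDegree < p ∧ aeval α g = 0)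
    [IsGalois k E] (h : Module.finrank k E = p) :
    ∃ f : k'[X], IsGalois k' f.SplittingField ∧ Module.finrank k' f.SplittingField = p := by
  have : FiniteDimensional k E := Module.finite_of_finrank_pos (h ▸ hp.pos)
  obtain ⟨θ, hθ⟩ := Field.exists_primitive_element k E
  have hint := Algebra.IsIntegral.isIntegral (R := k) θ
  set f := minpoly k θ
  have hfdeg : f.natDegree = p := by
    rw [← h, Field.primitive_element_iff_minpoly_natDegree_eq k θ |>.1 hθ]
  let F := (f.map (algebraMap k k')).SplittingField
  have hsplit : (f.map (algebraMap k F)).Splits := by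
    have := SplittingField.splits (f.map (algebraMap k k'))
    rwa [Polynomial.map_map, ← IsScalarTower.algebraMap_eq] at this
  have hfE : (f.map (algebraMap k E)).Splits := Normal.splits inferInstance θ
  have hE : IsSplittingField k E f := by
    refine ⟨hfE, ?_⟩
    rw [eq_top_iff, ← IntermediateField.top_toSubalgebra, ← hθ,
      IntermediateField.adjoin_simple_toSubalgebra_of_isAlgebraic hint.isAlgebraic]
    refine Algebra.adjoin_mono (Set.singleton_subset_iff.2 ?_)
    exact mem_rootSet.2 ⟨minpoly.ne_zero hint, minpoly.aeval k θ⟩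
  let φ : E →ₐ[k] F := IsSplittingField.lift E f hsplit
  let _ : Algebra E F := φ.toAlgebra
  have : IsScalarTower k E F := IsScalarTower.of_algebraMap_eq fun x ↦ (φ.commutes x).symm
  have hGal : IsGalois k' F := IsGalois.of_separable_splitting_field
    (p := f.map (algebraMap k k')) (Separable.map (Algebra.IsSeparable.isSeparable k θ))
  let ψ : Gal(F/k') →* Gal(E/k) :=
    (AlgEquiv.restrictNormalHom E).comp (AlgEquiv.restrictScalarsHom k)
  have hψ : Function.Injective ψ := by
    refine (injective_iff_map_eq_one ψ).2 fun σ hσ ↦ ?_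
    have hφ : ∀ e, σ (φ e) = φ e := fun e ↦ by
      have := AlgEquiv.restrictNormal_commutes (AlgEquiv.restrictScalars k σ) E e
      rw [show (AlgEquiv.restrictScalars k σ).restrictNormal E = 1 from hσ] at this
      exact this.symm
    have := AlgHom.ext_of_adjoin_eq_top (SplittingField.adjoin_rootSet (f.map (algebraMap k k')))
      (φ₁ := (σ : F →ₐ[k'] F)) (φ₂ := AlgHom.id k' F) (fun r hr ↦ by
        have hr' : r ∈ f.rootSet F := by
          rw [mem_rootSet] at hr ⊢
          exact ⟨minpoly.ne_zero hint, by simpa using hr.2⟩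
        rw [← hfE.image_rootSet φ] at hr'
        obtain ⟨e, -, rfl⟩ := hr'
        exact hφ e)
    exact AlgEquiv.ext fun x ↦ DFunLike.congr_fun this x
  refine ⟨f.map (algebraMap k k'), hGal, ?_⟩
  have hdvd := Subgroup.card_dvd_of_injective ψ hψ
  rw [IsGalois.card_aut_eq_finrank, IsGalois.card_aut_eq_finrank, h] at hdvd
  refine ((Nat.dvd_prime hp).1 hdvd).resolve_left fun h1 ↦ ?_
  obtain ⟨α, hα⟩ : ∃ α : k', algebraMap k' F α = φ θ := by
    have : φ θ ∈ (⊥ : Subalgebra k' F) := by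
      rw [Subalgebra.bot_eq_top_of_finrank_eq_one h1]
      trivial
    exact Algebra.mem_bot.1 this
  obtain ⟨g, hgm, hgd, hg⟩ := hdeg α
  have hgθ : aeval θ g = 0 := by
    refine (show Function.Injective φ from φ.toRingHom.injective) ?_
    rw [← aeval_algHom_apply, ← hα, aeval_algebraMap_apply, hg, map_zero, map_zero]
  have := natDegree_le_natDegree (minpoly.min k θ hgm hgθ)
  rw [hfdeg] at this
  omega

lemma isSolvClosed_of_not_prime_finrank {k : Type u} [Field k]
    (h : ∀ (F : Type u) [Field F] [Algebra k F] [IsGalois k F], ¬ (Module.finrank k F).Prime) :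
    IsSolvClosed k := by
  intro ℓ hfin hgal hsolv
  by_contra hne
  have hsolv' : Group.IsSolvable (ℓ ≃ₐ[k] ℓ) := hsolv
  have h1 : Module.finrank k ℓ ≠ 1 := mt IntermediateField.finrank_eq_one_iff.1 hne
  obtain ⟨F, hF, hp⟩ := IsGalois.exists_intermediateField_finrank_prime h1
  exact h F hp

end Galois

section SolvableClosure

open IntermediateField

variable {K Ω : Type*} [Field K] [Field Ω] [Algebra K Ω]

instance isGalois_maxSolvableExt : IsGalois K (maxSolvableExt K Ω) where
  to_isSeparable := isSeparable_iSup K Ω (h := fun L ↦ have := L.2.2.1; inferInstance)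
  to_normal := normal_iSup K Ω _ (h := fun L ↦ have := L.2.2.1; inferInstance)

lemma mem_maxSolvableExt_of_isSolvable_gal [Normal K Ω] {x : Ω} (hx : IsSeparable K x)
    (hs : Group.IsSolvable (minpoly K x).Gal) : x ∈ maxSolvableExt K Ω := by
  let L := adjoin K ((minpoly K x).rootSet Ω)
  have hL : IsSplittingField K L (minpoly K x) :=
    adjoin_rootSet_isSplittingField (Normal.splits inferInstance x)
  have h1 : FiniteDimensional K L := IsSplittingField.finiteDimensional L (minpoly K x)
  have h2 : IsGalois K L := IsGalois.of_separable_splitting_field (p := minpoly K x) hx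
  have hs' : Group.IsSolvable
      ((minpoly K x).SplittingField ≃ₐ[K] (minpoly K x).SplittingField) := hs
  have h3 : Group.IsSolvable Gal(L/K) := Group.isSolvable_of_isSolvable_injective
    (f := (AlgEquiv.autCongr (IsSplittingField.algEquiv L (minpoly K x))).toMonoidHom)
    (MulEquiv.injective _)
  have hle : L ≤ maxSolvableExt K Ω := le_iSup_of_le ⟨L, h1, h2, h3⟩ le_rfl
  refine hle ?_
  exact subset_adjoin _ _ (mem_rootSet.2
    ⟨minpoly.ne_zero hx.isIntegral, minpoly.aeval K x⟩)

lemma isSolvable_gal_minpoly_of_artinSchreier {p : ℕ} [Fact p.Prime] [CharP K p] {y : Ω} {t : K}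
    (hy : y ^ p - y = algebraMap K Ω t) : Group.IsSolvable (minpoly K y).Gal := by
  let F := (minpoly K y).SplittingField
  have : CharP F p := charP_of_injective_algebraMap (algebraMap K F).injective p
  have key : ∀ r ∈ (minpoly K y).rootSet F, ∀ σ : Gal(F/K), ∃ i : ℕ, σ r = r + i := by
    intro r hr σ
    have hd : minpoly K y ∣ X ^ p - X - C t := minpoly.dvd K y (by simp [hy])
    have h0 : aeval r (X ^ p - X - C t) = 0 := by
      obtain ⟨q, hq⟩ := hd
      rw [hq, map_mul, (mem_rootSet.1 hr).2, zero_mul]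
    simp only [map_sub, map_pow, aeval_X, aeval_C] at h0
    have h1 := congrArg σ h0
    simp only [map_sub, map_pow, AlgEquiv.commutes, map_zero] at h1
    have h2 : kummerArtinSchreier p 1 (σ r - r) = 0 := by
      rw [kummerArtinSchreier_one_of_charP, sub_pow_char]
      linear_combination h1 - h0
    obtain ⟨i, -, hi⟩ := prod_eq_zero_iff.1 h2
    refine ⟨i, ?_⟩
    simp only [one_pow, sum_const, card_range, nsmul_eq_mul, mul_one] at hi
    linear_combination hi
  refine Group.isSolvable_of_comm fun (σ τ : Gal(F/K)) ↦ ?_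
  have := AlgHom.ext_of_adjoin_eq_top (SplittingField.adjoin_rootSet (minpoly K y))
    (φ₁ := ((σ * τ : Gal(F/K)) : F →ₐ[K] F)) (φ₂ := ((τ * σ : Gal(F/K)) : F →ₐ[K] F))
    fun r hr ↦ by
      obtain ⟨i, hi⟩ := key r hr σ
      obtain ⟨j, hj⟩ := key r hr τ
      simp [AlgEquiv.mul_apply, hi, hj, add_right_comm]
  exact AlgEquiv.ext fun x ↦ DFunLike.congr_fun this x

variable (K Ω) in
lemma exists_mem_maxSolvableExt_geom_sum_eq_zero [IsAlgClosed Ω] [Normal K Ω] {p : ℕ}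
    (hp : p.Prime) : ∃ ζ ∈ maxSolvableExt K Ω, ∑ j ∈ range p, ζ ^ j = 0 := by
  by_cases hchar : (p : K) = 0
  · refine ⟨1, one_mem _, ?_⟩
    simpa using congrArg (algebraMap K Ω) hchar
  · have hpΩ : NeZero (p : Ω) := ⟨fun h ↦ hchar ((algebraMap K Ω).injective (by simpa using h))⟩
    obtain ⟨ζ, hζ⟩ := HasEnoughRootsOfUnity.exists_primitiveRoot Ω p
    refine ⟨ζ, mem_maxSolvableExt_of_isSolvable_gal ?_ ?_, hζ.geom_sum_eq_zero hp.one_lt⟩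
    · refine (Polynomial.separable_X_pow_sub_C (1 : K) hchar one_ne_zero).of_dvd ?_
      exact minpoly.dvd K ζ (by simp [hζ.pow_eq_one])
    · exact isSolvable_gal_minpoly (solvableByRad.rad_mem hp.ne_zero
        (by rw [hζ.pow_eq_one]; exact one_mem _))

lemma exists_mem_maxSolvableExt_kummerArtinSchreier_eq [IsAlgClosed Ω] [Normal K Ω] {p : ℕ}
    (hp : p.Prime) {ζ : Ω} (hζL : ζ ∈ maxSolvableExt K Ω) (hζ : ∑ j ∈ range p, ζ ^ j = 0)
    {t : Ω} (ht : t ∈ K⟮ζ⟯) : ∃ y ∈ maxSolvableExt K Ω, kummerArtinSchreier p ζ y = t := by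
  have hpf : Fact p.Prime := ⟨hp⟩
  have htL : t ∈ maxSolvableExt K Ω := adjoin_simple_le_iff.2 hζL ht
  rcases isPrimitiveRoot_or_of_geom_sum_eq_zero hp hζ with hprim | ⟨rfl, hchar⟩
  · have hζ1 : ζ - 1 ≠ 0 := sub_ne_zero.2 (hprim.ne_one hp.one_lt)
    have hζrad : ζ ∈ solvableByRad K Ω :=
      solvableByRad.rad_mem hp.ne_zero (by rw [hprim.pow_eq_one]; exact one_mem _)
    have htrad : t ∈ solvableByRad K Ω := adjoin_simple_le_iff.2 hζrad ht
    set c := 1 + (ζ - 1) ^ p * t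
    obtain ⟨x, hx⟩ := IsAlgClosed.exists_pow_nat_eq c hp.pos
    have hxL : x ∈ maxSolvableExt K Ω := by
      by_cases hx0 : x = 0
      · rw [hx0]; exact zero_mem _
      refine mem_maxSolvableExt_of_isSolvable_gal ?_
        (isSolvable_gal_minpoly (solvableByRad.rad_mem hp.ne_zero (hx ▸ ?_)))
      · have hcL : c ∈ maxSolvableExt K Ω :=
          add_mem (one_mem _) (mul_mem (pow_mem (sub_mem hζL (one_mem _)) _) htL)
        refine IsSeparable.of_algebra_isSeparable_of_isSeparable (E := maxSolvableExt K Ω) K ?_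
        have hp0 : (p : maxSolvableExt K Ω) ≠ 0 := fun h ↦ by
          have h' : (p : Ω) = 0 := by simpa using congrArg (algebraMap _ Ω) h
          have : CharP Ω p := ringChar.of_eq (CharP.ringChar_of_prime_eq_zero hp h')
          refine hζ1 (pow_eq_zero_iff hp.ne_zero |>.1 (?_ : (ζ - 1) ^ p = 0))
          rw [sub_pow_char, hprim.pow_eq_one, one_pow, sub_self]
        have hc0 : (⟨c, hcL⟩ : maxSolvableExt K Ω) ≠ 0 := fun h ↦
          pow_ne_zero p hx0 (hx.trans (congrArg Subtype.val h))
        refine (Polynomial.separable_X_pow_sub_C _ hp0 hc0).of_dvd ?_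
        exact minpoly.dvd _ x (by simp [hx])
      · exact add_mem (one_mem _) (mul_mem (pow_mem (sub_mem hζrad (one_mem _)) _) htrad)
    refine ⟨(x - 1) / (ζ - 1), div_mem (sub_mem hxL (one_mem _)) (sub_mem hζL (one_mem _)), ?_⟩
    refine mul_left_cancel₀ (pow_ne_zero p hζ1) ?_
    rw [mul_kummerArtinSchreier_of_isPrimitiveRoot hprim hp.pos, mul_div_cancel₀ _ hζ1]
    rw [add_sub_cancel, hx, add_sub_cancel_left]
  · rw [adjoin_one, mem_bot] at ht
    obtain ⟨t, rfl⟩ := ht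
    have hcharK : CharP K p := (algebraMap K Ω).charP (algebraMap K Ω).injective p
    obtain ⟨y, hy⟩ := IsAlgClosed.exists_root (X ^ p - X - C (algebraMap K Ω t)) (by
      rw [sub_sub, degree_sub_eq_left_of_degree_lt]
      · simp [hp.ne_zero]
      · rw [degree_X_add_C, degree_X_pow]
        exact_mod_cast hp.one_lt)
    have hy : y ^ p - y = algebraMap K Ω t := by simpa [sub_eq_zero] using hy
    refine ⟨y, mem_maxSolvableExt_of_isSolvable_gal ?_
      (isSolvable_gal_minpoly_of_artinSchreier (p := p) hy), ?_⟩
    · have : (X ^ p - X - C t : K[X]).Separable := by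
        refine ⟨0, -1, ?_⟩
        simp [derivative_X_pow]
      exact this.of_dvd (minpoly.dvd K y (by simp [hy]))
    · rw [kummerArtinSchreier_one_of_charP, hy]

end SolvableClosure

section SolvHenselian

variable {K L : Type*} [Field K] [Field L] [Algebra K L]

lemma IsSolvHenselian.exists_comap_eq_of_invariant {O : ValuationSubring K}
    (h : IsSolvHenselian O) : ∃ O' : ValuationSubring (solvClosure K),
      O'.comap (algebraMap K (solvClosure K)) = O ∧
      ∀ σ : Gal(solvClosure K/K), ∀ x ∈ O', σ x ∈ O' := by
  obtain ⟨O', hO', huniq⟩ := h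
  refine ⟨O', hO', fun σ x hx ↦ ?_⟩
  have : O'.comap (σ : solvClosure K →+* solvClosure K) = O' := huniq _ <| by
    ext y
    simp [← hO', ValuationSubring.mem_comap]
  rw [← this] at hx
  exact hx

lemma ValuationSubring.exists_monic_map_eq_minpoly [IsGalois K L] {O : ValuationSubring K}
    {O' : ValuationSubring L} (hO : O'.comap (algebraMap K L) = O)
    (hO' : ∀ σ : Gal(L/K), ∀ x ∈ O', σ x ∈ O') {x : L} (hx : x ∈ O') :
    ∃ g : O[X], g.Monic ∧ g.map (algebraMap O K) = minpoly K x := by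
  have hint : IsIntegral K x := Algebra.IsIntegral.isIntegral x
  have hlift : (minpoly K x).map (algebraMap K L) ∈ lifts O'.subtype := by
    rw [(Normal.splits inferInstance x : ((minpoly K x).map (algebraMap K L)).Splits).eq_prod_roots,
      ((minpoly.monic hint).map _).leadingCoeff, C_1, one_mul]
    refine multiset_prod_mem _ fun q hq ↦ ?_
    obtain ⟨r, hr, rfl⟩ := Multiset.mem_map.1 hq
    obtain ⟨σ, rfl⟩ := minpoly.exists_algEquiv_of_root' (K := K) hint.isAlgebraic
      (show aeval r (minpoly K x) = 0 by
        rw [aeval_def, ← eval_map]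
        exact (mem_roots'.1 hr).2)
    exact (mem_lifts _).2 ⟨X - C ⟨σ x, hO' σ x hx⟩, by simp⟩
  have hliftK : minpoly K x ∈ lifts (algebraMap O K) := by
    rw [lifts_iff_coeff_lifts] at hlift ⊢
    intro n
    obtain ⟨c, hc⟩ := hlift n
    rw [coeff_map] at hc
    refine ⟨⟨(minpoly K x).coeff n, ?_⟩, rfl⟩
    rw [← hO, mem_comap, ← hc]
    exact c.2
  obtain ⟨g, hg, -, hmon⟩ := lifts_and_natDegree_eq_and_monic hliftK (minpoly.monic hint)
  exact ⟨g, hmon, hg⟩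

/-- The residue field of a Galois-invariant valuation ring, restricted to an intermediate field
`M` of finite degree `n`, consists of elements of degree at most `n` over the residue field below. -/
lemma ValuationSubring.exists_algebra_residueField_degree_le [IsGalois K L]
    (M : IntermediateField K L) [FiniteDimensional K M] {O : ValuationSubring K}
    {O' : ValuationSubring L} (hO : O'.comap (algebraMap K L) = O)
    (hO' : ∀ σ : Gal(L/K), ∀ x ∈ O', σ x ∈ O') :
    ∃ _ : Algebra (IsLocalRing.ResidueField O)
        (IsLocalRing.ResidueField (O'.comap (algebraMap M L))),
      ∀ α : IsLocalRing.ResidueField (O'.comap (algebraMap M L)),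
        ∃ g : (IsLocalRing.ResidueField O)[X],
          g.Monic ∧ g.natDegree ≤ Module.finrank K M ∧ aeval α g = 0 := by
  set A := O'.comap (algebraMap M L) with hA
  have hmem (x : K) : algebraMap K M x ∈ A ↔ x ∈ O := by
    rw [← hO]
    rfl
  let ι : O →+* A := ((algebraMap K M).comp O.subtype).codRestrict A.toSubring
    fun x ↦ (hmem x).2 x.2
  have hι : IsLocalHom ι := ⟨fun x hx ↦ by
    have hx0 : (x : K) ≠ 0 := fun h ↦ hx.ne_zero (by rw [show x = 0 from Subtype.ext h, map_zero])
    obtain ⟨y, hy⟩ := isUnit_iff_exists_inv.1 hx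
    have hy' : algebraMap K M x * y = 1 := congrArg Subtype.val hy
    have hinv : (x : K)⁻¹ ∈ O := by
      rw [← hmem, map_inv₀, ← eq_inv_of_mul_eq_one_right hy']
      exact y.2
    exact isUnit_iff_exists_inv.2 ⟨⟨_, hinv⟩, Subtype.ext (mul_inv_cancel₀ hx0)⟩⟩
  let := (IsLocalRing.ResidueField.map ι).toAlgebra
  refine ⟨this, fun α ↦ ?_⟩
  obtain ⟨x, rfl⟩ := IsLocalRing.residue_surjective α
  obtain ⟨g, hg, hgx⟩ := exists_monic_map_eq_minpoly hO hO' x.2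
  have hminpoly : minpoly K (algebraMap M L x) = minpoly K (x : M) :=
    minpoly.algebraMap_eq (algebraMap M L).injective _
  refine ⟨g.map (IsLocalRing.residue O), hg.map _, ?_, ?_⟩
  · rw [hg.natDegree_map, ← hg.natDegree_map (algebraMap O K), hgx, hminpoly]
    exact minpoly.natDegree_le _
  · have hgA : eval₂ ι x g = 0 := A.subtype_injective <| by
      rw [hom_eval₂, map_zero]
      have := minpoly.aeval K (x : M)
      rwa [← hminpoly, ← hgx, aeval_def, eval₂_map] at this
    rw [aeval_def, eval₂_map]
    have := congrArg (IsLocalRing.residue A) hgA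
    rwa [hom_eval₂, map_zero] at this

open IntermediateField

lemma IntermediateField.finrank_adjoin_lt_of_geom_sum_eq_zero {p : ℕ} (hp : p ≠ 0) {ζ : L}
    (hζ : ∑ j ∈ range p, ζ ^ j = 0) : FiniteDimensional K K⟮ζ⟯ ∧ Module.finrank K K⟮ζ⟯ < p := by
  have hdeg : (∑ j ∈ range p, X ^ j : K[X]).natDegree < p := by
    refine (natDegree_sum_le _ _).trans_lt ?_
    rw [Finset.fold_max_lt]
    exact ⟨Nat.pos_of_ne_zero hp, fun j hj ↦ by simpa using hj⟩
  have hmon : (∑ j ∈ range p, X ^ j : K[X]).Monic := monic_geom_sum_X hp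
  have hroot : aeval ζ (∑ j ∈ range p, X ^ j : K[X]) = 0 := by simpa using hζ
  have hint : IsIntegral K ζ := ⟨_, hmon, hroot⟩
  refine ⟨adjoin.finiteDimensional hint, ?_⟩
  rw [adjoin.finrank hint]
  exact (natDegree_le_of_dvd (minpoly.dvd K ζ hroot) hmon.ne_zero).trans_lt hdeg

/-- Given two incomparable solv-henselian valuation rings, the maps `kummerArtinSchreier p ζ` are
surjective on the residue field of a prolongation of the first one to `K⟮ζ⟯`. -/
lemma surjective_kummerArtinSchreier_residueField {O₁' O₂' : ValuationSubring (solvClosure K)}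
    (h12 : ¬ O₁'.comap (algebraMap K (solvClosure K)) ≤ O₂'.comap (algebraMap K (solvClosure K)))
    (h21 : ¬ O₂'.comap (algebraMap K (solvClosure K)) ≤ O₁'.comap (algebraMap K (solvClosure K)))
    (hO₂' : ∀ σ : Gal(solvClosure K/K), ∀ x ∈ O₂', σ x ∈ O₂') {p : ℕ} (hp : p.Prime)
    {ζ : solvClosure K} (hζ : ∑ j ∈ range p, ζ ^ j = 0) :
    ∃ z : IsLocalRing.ResidueField (O₁'.comap (algebraMap K⟮ζ⟯ (solvClosure K))),
      ∑ j ∈ range p, z ^ j = 0 ∧ Function.Surjective (kummerArtinSchreier p z) := by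
  set A := O₁'.comap (algebraMap K⟮ζ⟯ (solvClosure K)) with hA
  set B := O₂'.comap (algebraMap K⟮ζ⟯ (solvClosure K)) with hB
  have hAB : ¬ A ≤ B := fun h ↦ h12 fun x hx ↦ h (x := algebraMap K K⟮ζ⟯ x) hx
  have hBA : ¬ B ≤ A := fun h ↦ h21 fun x hx ↦ h (x := algebraMap K K⟮ζ⟯ x) hx
  have hgen : ∑ j ∈ range p, AdjoinSimple.gen K ζ ^ j = 0 :=
    (algebraMap K⟮ζ⟯ (solvClosure K)).injective (by simpa using hζ)
  let ζA : A := ⟨AdjoinSimple.gen K ζ,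
    A.mem_of_pow_eq_one hp.ne_zero (pow_eq_one_of_geom_sum_eq_zero hgen)⟩
  have hζA : ∑ j ∈ range p, ζA ^ j = 0 := Subtype.ext (by simpa [ζA] using hgen)
  refine ⟨IsLocalRing.residue A ζA, ?_, ?_⟩
  · simpa using congrArg (IsLocalRing.residue A) hζA
  refine ValuationSubring.exists_kummerArtinSchreier_residue_eq hAB hBA hp.ne_zero ζA fun t ht ↦ ?_
  have htΩ : ((t : solvClosure K) : AlgebraicClosure K) ∈ K⟮(ζ : AlgebraicClosure K)⟯ := by
    have := lift_adjoin_simple K (solvClosure K) ζ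
    rw [← this]
    exact (mem_lift _).2 t.2
  obtain ⟨y, hyL, hy⟩ := exists_mem_maxSolvableExt_kummerArtinSchreier_eq hp ζ.2
    (by simpa using congrArg (algebraMap (solvClosure K) (AlgebraicClosure K)) hζ) htΩ
  refine ValuationSubring.exists_kummerArtinSchreier_eq_of_mem_nonunits (M := K⟮ζ⟯) O₂'
    (fun σ x hx ↦ hO₂' (σ.restrictScalars K) x hx) hp hgen (t := t) (y := ⟨y, hyL⟩) ?_ ?_
  · rw [ValuationSubring.mem_nonunits_iff_or] at ht ⊢
    refine ht.imp (fun h ↦ by rw [h, map_zero]) fun h ↦ ?_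
    rwa [hB, ValuationSubring.mem_comap, map_inv₀] at h
  · refine (algebraMap (solvClosure K) (AlgebraicClosure K)).injective ?_
    rw [map_kummerArtinSchreier]
    exact hy

lemma IsSolvHenselian.isSolvClosed_residueField {O₁ O₂ : ValuationSubring K}
    (h1 : IsSolvHenselian O₁) (h2 : IsSolvHenselian O₂) (h12 : ¬ O₁ ≤ O₂) (h21 : ¬ O₂ ≤ O₁) :
    IsSolvClosed (IsLocalRing.ResidueField O₁) := by
  obtain ⟨O₁', hO₁, hinv₁⟩ := h1.exists_comap_eq_of_invariant
  obtain ⟨O₂', rfl, hinv₂⟩ := h2.exists_comap_eq_of_invariant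
  refine isSolvClosed_of_not_prime_finrank fun F _ _ _ hp ↦ ?_
  set p := Module.finrank (IsLocalRing.ResidueField O₁) F with hpF
  obtain ⟨ζΩ, hζL, hζΩ⟩ :=
    exists_mem_maxSolvableExt_geom_sum_eq_zero K (AlgebraicClosure K) hp
  let ζ : solvClosure K := ⟨ζΩ, hζL⟩
  have hζ : ∑ j ∈ range p, ζ ^ j = 0 := Subtype.ext (by simpa [ζ] using hζΩ)
  obtain ⟨z, hz, hsurj⟩ := surjective_kummerArtinSchreier_residueField
    (by rwa [hO₁]) (by rwa [hO₁]) hinv₂ hp hζ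
  obtain ⟨hfd, hlt⟩ := IntermediateField.finrank_adjoin_lt_of_geom_sum_eq_zero (K := K)
    hp.ne_zero hζ
  obtain ⟨algRes, hdeg⟩ := ValuationSubring.exists_algebra_residueField_degree_le K⟮ζ⟯ hO₁ hinv₁
  obtain ⟨f, hf, hfp⟩ := IsGalois.exists_finrank_eq_of_degree_lt
    (k' := IsLocalRing.ResidueField (O₁'.comap (algebraMap K⟮ζ⟯ (solvClosure K)))) hp (fun α ↦ by
      obtain ⟨g, hg, hgd, hgα⟩ := hdeg α
      exact ⟨g, hg, hgd.trans_lt hlt, hgα⟩) hpF.symm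
  exact IsGalois.finrank_ne_of_surjective_kummerArtinSchreier hp hz hsurj hfp

end SolvHenselian

/-- If `O₁` and `O₂` are incomparable solv-henselian valuation rings of
`K`, then both residue fields are solv-closed. -/
theorem statement_13 (K : Type) [Field K] (O₁ O₂ : ValuationSubring K)
    (h1 : IsSolvHenselian O₁) (h2 : IsSolvHenselian O₂)
    (h12 : ¬ O₁ ≤ O₂) (h21 : ¬ O₂ ≤ O₁) :
    IsSolvClosed (IsLocalRing.ResidueField ↥O₁) ∧
    IsSolvClosed (IsLocalRing.ResidueField ↥O₂) := by
  exact ⟨h1.isSolvClosed_residueField h2 h12 h21, h2.isSolvClosed_residueField h1 h21 h12⟩
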